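/- arXiv:1603.04087 — 2 statements merged into one kernel-verified Lean document; each statement's English description precedes it below -/
import Mathlib

section
/- Let F ∈ k[x₀,...,x₄] be a nonzero homogeneous polynomial of degree 3 such that the hypersurface Y = {F = 0} ⊂ ℙ⁴ has only finitely many singular points. If four pairwise distinct singular points of Y all lie on a plane P ⊂ ℙ⁴ (the projectivization of a 3-dimensional linear subspace of k⁵), then P is contained in Y (i.e. F vanishes identically on the corresponding 3-dimensional subspace), and every singular point of Y lying on P is one of these four points. -/
open MvPolynomial

section
variable {k : Type} [Field k] [CharZero k] {V : Type} [AddCommGroup V] [Module k V]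

lemma aux_indep (T : V →ₗ[k] V →ₗ[k] V →ₗ[k] k)
    (h12 : ∀ u v w, T u v w = T v u w)
    (Hfin : ∀ (f : k → V) (I : Set k), I.Infinite → (∀ t ∈ I, ∀ v, T (f t) (f t) v = 0) →
      (∀ t ∈ I, f t ≠ 0) → (∀ s ∈ I, ∀ t ∈ I, ∀ c : k, c • f t = f s → s = t) → False)
    (u v w : V) (hu : ∀ x, T u u x = 0) (hv : ∀ x, T v v x = 0) (hw : ∀ x, T w w x = 0)
    (huv : LinearIndependent k ![u, v]) (huw : LinearIndependent k ![u, w])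
    (hvw : LinearIndependent k ![v, w]) :
    LinearIndependent k ![u, v, w] := by
  rw [LinearIndependent.pair_iff] at huv huw hvw
  rw [Fintype.linearIndependent_iff]
  intro g hg
  simp only [Fin.sum_univ_three, Matrix.cons_val_zero, Matrix.cons_val_one, Matrix.cons_val] at hg
  obtain ⟨x, hx⟩ : ∃ x, x = g 0 := ⟨_, rfl⟩
  obtain ⟨y, hy⟩ : ∃ x, x = g 1 := ⟨_, rfl⟩
  obtain ⟨z, hz⟩ : ∃ x, x = g 2 := ⟨_, rfl⟩
  rw [← hx, ← hy, ← hz] at hg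
  suffices x = 0 ∧ y = 0 ∧ z = 0 by
    intro i; fin_cases i
    · exact hx ▸ this.1
    · exact hy ▸ this.2.1
    · exact hz ▸ this.2.2
  by_cases hz0 : z = 0
  · subst hz0
    have := huv x y (by simpa using hg)
    exact ⟨this.1, this.2, rfl⟩
  by_cases hx0 : x = 0
  · subst hx0
    exact absurd (hvw y z (by simpa using hg)).2 hz0
  by_cases hy0 : y = 0
  · subst hy0
    exact absurd (huw x z (by simpa using hg)).2 hz0
  exfalso
  have key : ∀ r, T u v r = 0 := by
    intro r
    have e : z • w = -(x • u + y • v) := by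
      rw [eq_neg_iff_add_eq_zero, add_comm]; exact hg
    have h1 : T (z • w) (z • w) r = 0 := by simp [hw]
    rw [e] at h1
    simp [hu, hv, h12 v u] at h1
    have h2 : 2 * x * y * T u v r = 0 := by linear_combination h1
    simpa [hx0, hy0] using h2
  refine Hfin (fun t => u + t • v) Set.univ Set.infinite_univ ?_ ?_ ?_
  · intro t _ r
    simp [hu, hv, h12 v u, key]
  · intro t _ h
    exact one_ne_zero (huv 1 t (by simpa using h)).1
  · intro s _ t _ c h
    have h' : (c - 1) • u + (c * t - s) • v = 0 := by
      rw [← sub_eq_zero] at h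
      rw [← h]; module
    obtain ⟨h1, h2⟩ := huv _ _ h'
    linear_combination -h2 + t * h1

lemma aux_main (T : V →ₗ[k] V →ₗ[k] V →ₗ[k] k)
    (h12 : ∀ u v w, T u v w = T v u w) (h23 : ∀ u v w, T u v w = T u w v)
    (Hfin : ∀ (f : k → V) (I : Set k), I.Infinite → (∀ t ∈ I, ∀ v, T (f t) (f t) v = 0) →
      (∀ t ∈ I, f t ≠ 0) → (∀ s ∈ I, ∀ t ∈ I, ∀ c : k, c • f t = f s → s = t) → False)
    (a b c : V) (ha : ∀ x, T a a x = 0) (hb : ∀ x, T b b x = 0) (hc : ∀ x, T c c x = 0)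
    (hd : ∀ x, T (a + b + c) (a + b + c) x = 0)
    (hind : LinearIndependent k ![a, b, c]) (x y z : k) :
    (let w := x • a + y • b + z • c; T w w w = 0) ∧
    ((∀ v, T (x • a + y • b + z • c) (x • a + y • b + z • c) v = 0) →
      (x = 0 ∧ y = 0) ∨ (y = 0 ∧ z = 0) ∨ (x = 0 ∧ z = 0) ∨ (x = y ∧ y = z)) := by
  have hd' : ∀ v, T a b v + T b c v + T a c v = 0 := by
    intro v
    have h := hd v
    simp [ha, hb, hc, h12 b a, h12 c a, h12 c b] at h
    have h2 : 2 * (T a b v + T b c v + T a c v) = 0 := by linear_combination h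
    simpa using h2
  have quad : ∀ x y z v, T (x • a + y • b + z • c) (x • a + y • b + z • c) v
      = 2 * (x * y * T a b v + y * z * T b c v + x * z * T a c v) := by
    intro x y z v
    simp [ha, hb, hc, h12 b a, h12 c a, h12 c b]
    ring
  have e1 : T a b a = 0 := by rw [h23, ha]
  have e2 : T a b b = 0 := by rw [h12, h23, hb]
  have e3 : T b c b = 0 := by rw [h23, hb]
  have e4 : T b c c = 0 := by rw [h12, h23, hc]
  have e5 : T a c a = 0 := by rw [h23, ha]
  have e6 : T a c c = 0 := by rw [h12, h23, hc]
  have f1 : T b c a = 0 := by have := hd' a; rw [e1, e5] at this; simpa using this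
  have f2 : T a c b = 0 := by have := hd' b; rw [e2, e3] at this; simpa using this
  have f3 : T a b c = 0 := by have := hd' c; rw [e4, e6] at this; simpa using this
  refine ⟨?_, ?_⟩
  · intro w
    rw [quad]
    simp [w, e1, e2, e3, e4, e5, e6, f1, f2, f3]
  intro hs
  by_contra hcon
  have hs' : ∀ v, x * y * T a b v + y * z * T b c v + x * z * T a c v = 0 := by
    intro v
    have := hs v
    rw [quad] at this
    simpa using this
  obtain ⟨A, hA⟩ : ∃ A, A = y * z - x * z := ⟨_, rfl⟩
  obtain ⟨B, hB⟩ : ∃ B, B = x * z - x * y := ⟨_, rfl⟩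
  obtain ⟨C, hC⟩ : ∃ C, C = x * y - y * z := ⟨_, rfl⟩
  have hBC : ¬ (B = 0 ∧ C = 0) := by
    rintro ⟨h1, h2⟩
    apply hcon
    have g1 : x * (z - y) = 0 := by linear_combination h1 - hB
    have g2 : y * (x - z) = 0 := by linear_combination h2 - hC
    rcases mul_eq_zero.1 g1 with g1 | g1 <;> rcases mul_eq_zero.1 g2 with g2 | g2
    · exact Or.inl ⟨g1, g2⟩
    · exact Or.inr (Or.inr (Or.inl ⟨g1, by linear_combination g1 - g2⟩))
    · exact Or.inr (Or.inl ⟨g2, by linear_combination g1 + g2⟩)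
    · exact Or.inr (Or.inr (Or.inr ⟨by linear_combination g1 + g2, by linear_combination -g1⟩))
  have p1 : ∀ v, T a b v * B = T b c v * A := by
    intro v; subst hA hB hC; linear_combination x * z * hd' v - hs' v
  have p2 : ∀ v, T a b v * C = T a c v * A := by
    intro v; subst hA hB hC; linear_combination hs' v - y * z * hd' v
  have p3 : ∀ v, T b c v * C = T a c v * B := by
    intro v; subst hA hB hC; linear_combination x * y * hd' v - hs' v
  have conic : ∀ X Y Z, A * (X * Y) + B * (Y * Z) + C * (X * Z) = 0 →
      ∀ v, T (X • a + Y • b + Z • c) (X • a + Y • b + Z • c) v = 0 := by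
    intro X Y Z h v
    rw [quad]
    have q2 : B * (X * Y * T a b v + Y * Z * T b c v + X * Z * T a c v) = 0 := by
      linear_combination X * Y * p1 v - X * Z * p3 v + T b c v * h
    have q3 : C * (X * Y * T a b v + Y * Z * T b c v + X * Z * T a c v) = 0 := by
      linear_combination X * Y * p2 v + Y * Z * p3 v + T a c v * h
    by_cases h0 : B = 0
    · have : C ≠ 0 := fun h => hBC ⟨h0, h⟩
      simpa [this] using q3
    · simpa [h0] using q2
  have hI : ({m : k | B * m + C ≠ 0}).Infinite := by
    have : ({m : k | B * m + C = 0}).Finite := by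
      by_cases h0 : B = 0
      · convert Set.finite_empty
        ext m
        simp only [h0, zero_mul, zero_add, Set.mem_ofPred_eq, Set.mem_empty_iff_false, iff_false]
        exact fun h => hBC ⟨h0, h⟩
      · refine (Set.finite_singleton (-C / B)).subset ?_
        intro m hm
        simp only [Set.mem_ofPred_eq] at hm
        simp only [Set.mem_singleton_iff]
        field_simp
        linear_combination hm
    exact this.infinite_compl
  have hind3 : ∀ X Y Z : k, X • a + Y • b + Z • c = 0 → X = 0 ∧ Y = 0 ∧ Z = 0 := by
    intro X Y Z h
    have := Fintype.linearIndependent_iff.1 hind ![X, Y, Z] (by simpa [Fin.sum_univ_three] using h)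
    exact ⟨this 0, this 1, this 2⟩
  refine Hfin (fun m => (1 : k) • a + m • b + (-(A * m) / (B * m + C)) • c) _ hI ?_ ?_ ?_
  · intro m hm
    apply conic
    simp only [Set.mem_ofPred_eq] at hm
    linear_combination div_mul_cancel₀ (-(A * m)) hm
  · intro m _ h
    exact one_ne_zero (hind3 _ _ _ h).1
  · intro s _ t _ r h
    rw [← sub_eq_zero] at h
    have h' := hind3 (r - 1) (r * t - s)
      (r * (-(A * t) / (B * t + C)) - (-(A * s) / (B * s + C))) (by rw [← h]; module)
    linear_combination -h'.2.1 + t * h'.1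

end

lemma aux_pderiv_comm {k : Type} [Field k] (i j : Fin 5) (F : MvPolynomial (Fin 5) k) :
    pderiv i (pderiv j F) = pderiv j (pderiv i F) := by
  have h : ⁅(pderiv i : Derivation k (MvPolynomial (Fin 5) k) (MvPolynomial (Fin 5) k)),
      (pderiv j : Derivation k (MvPolynomial (Fin 5) k) (MvPolynomial (Fin 5) k))⁆ = 0 := by
    apply MvPolynomial.derivation_ext
    intro m
    rw [Derivation.commutator_apply]
    simp [pderiv_X, Pi.single_apply, apply_ite]
  have := congrArg (fun D => D F) h
  simp only [Derivation.commutator_apply, Derivation.coe_zero, Pi.zero_apply] at this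
  exact sub_eq_zero.1 this

lemma aux_exists_T {k : Type} [Field k] (F : MvPolynomial (Fin 5) k) (hhom : F.IsHomogeneous 3) :
    ∃ T : (Fin 5 → k) →ₗ[k] (Fin 5 → k) →ₗ[k] (Fin 5 → k) →ₗ[k] k,
      (∀ u v w, T u v w = T v u w) ∧ (∀ u v w, T u v w = T u w v) ∧
      (∀ w v, T w w v = 2 * ∑ i, v i * eval w (pderiv i F)) ∧
      (∀ w, T w w w = 6 * eval w F) := by
  obtain ⟨c, hc⟩ : ∃ c : Fin 5 → Fin 5 → Fin 5 → k, ∀ i j l w,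
      eval w (pderiv i (pderiv j (pderiv l F))) = c i j l := by
    refine ⟨fun i j l => coeff 0 (pderiv i (pderiv j (pderiv l F))), fun i j l w => ?_⟩
    have h : (pderiv i (pderiv j (pderiv l F))).IsHomogeneous 0 :=
      (hhom.pderiv (i := l)).pderiv.pderiv
    have h0 : (pderiv i (pderiv j (pderiv l F))).totalDegree = 0 :=
      Nat.le_zero.1 h.totalDegree_le
    rw [totalDegree_eq_zero_iff_eq_C] at h0
    rw [h0]; simp
  have c12 : ∀ i j l, c i j l = c j i l := by
    intro i j l; rw [← hc i j l 0, aux_pderiv_comm, hc]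
  have c23 : ∀ i j l, c i j l = c i l j := by
    intro i j l; rw [← hc i j l 0, aux_pderiv_comm j l, hc]
  have eul : ∀ (n : ℕ) (G : MvPolynomial (Fin 5) k), G.IsHomogeneous n → ∀ w,
      ∑ i, w i * eval w (pderiv i G) = n * eval w G := by
    intro n G hG w
    have := congrArg (eval w) hG.sum_X_mul_pderiv
    simpa using this
  let T : (Fin 5 → k) →ₗ[k] (Fin 5 → k) →ₗ[k] (Fin 5 → k) →ₗ[k] k :=
    ∑ l, ∑ j, ∑ i, c i j l •
      (LinearMap.proj i : (Fin 5 → k) →ₗ[k] k).smulRight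
        ((LinearMap.proj j : (Fin 5 → k) →ₗ[k] k).smulRight
          (LinearMap.proj l : (Fin 5 → k) →ₗ[k] k))
  have hT : ∀ u v w, T u v w = ∑ l, ∑ j, ∑ i, c i j l * (u i * (v j * w l)) := by
    intro u v w
    simp [T, LinearMap.sum_apply]
  have hT2 : ∀ w v, T w w v = 2 * ∑ i, v i * eval w (pderiv i F) := by
    intro w v
    rw [hT, Finset.mul_sum]
    refine Finset.sum_congr rfl fun l _ => ?_
    have h1 := eul 2 (pderiv l F) hhom.pderiv w
    push_cast at h1
    rw [mul_left_comm, ← h1, Finset.mul_sum]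
    refine Finset.sum_congr rfl fun j _ => ?_
    have h2 := eul 1 (pderiv j (pderiv l F)) (hhom.pderiv (i := l)).pderiv w
    push_cast at h2
    rw [one_mul] at h2
    rw [← h2, Finset.mul_sum, Finset.mul_sum]
    refine Finset.sum_congr rfl fun i _ => ?_
    rw [hc]; ring
  refine ⟨T, ?_, ?_, hT2, ?_⟩
  · intro u v w
    rw [hT, hT]
    refine Finset.sum_congr rfl fun l _ => ?_
    rw [Finset.sum_comm]
    refine Finset.sum_congr rfl fun j _ => Finset.sum_congr rfl fun i _ => ?_
    rw [c12 j i]; ring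
  · intro u v w
    rw [hT, hT, Finset.sum_comm]
    refine Finset.sum_congr rfl fun l _ => Finset.sum_congr rfl fun j _ =>
      Finset.sum_congr rfl fun i _ => ?_
    rw [c23 i l j]; ring
  · intro w
    rw [hT2, eul 3 F hhom]
    push_cast; ring



/-- If four pairwise distinct singular points of a cubic threefold
`{F = 0} ⊂ ℙ⁴` with finitely many singular points lie on a plane `P` (the
projectivization of a 3-dimensional linear subspace `W ⊂ k⁵`), then `P ⊂ {F = 0}`
(`F` vanishes identically on `W`) and every singular point on `P` is one of the four. -/
theorem stmt_1 {k : Type} [Field k] [IsAlgClosed k] [CharZero k]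
    (F : MvPolynomial (Fin 5) k) (hF : F ≠ 0) (hhom : F.IsHomogeneous 3)
    (hfin : {x : Projectivization k (Fin 5 → k) |
        ∀ i, MvPolynomial.eval x.rep (MvPolynomial.pderiv i F) = 0}.Finite)
    (W : Submodule k (Fin 5 → k)) (hWdim : Module.finrank k W = 3)
    (p : Fin 4 → (Fin 5 → k)) (hp : ∀ i, p i ≠ 0)
    (hmem : ∀ i, p i ∈ W)
    (hdist : ∀ i j, i ≠ j →
      Projectivization.mk k (p i) (hp i) ≠ Projectivization.mk k (p j) (hp j))
    (hsing : ∀ i j, MvPolynomial.eval (p i) (MvPolynomial.pderiv j F) = 0) :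
    (∀ w ∈ W, MvPolynomial.eval w F = 0) ∧
    ∀ (s : Fin 5 → k) (hs : s ≠ 0), s ∈ W →
      (∀ j, MvPolynomial.eval s (MvPolynomial.pderiv j F) = 0) →
      ∃ i, Projectivization.mk k s hs = Projectivization.mk k (p i) (hp i) := by
  obtain ⟨T, h12, h23, hT2, hT3⟩ := aux_exists_T F hhom
  have sing_iff : ∀ w, (∀ v, T w w v = 0) ↔ ∀ i, eval w (pderiv i F) = 0 := by
    intro w
    constructor
    · intro h i
      have := h (Pi.single i 1)
      rw [hT2] at this
      simpa [Pi.single_apply] using this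
    · intro h v
      rw [hT2]; simp [h]
  have Hfin : ∀ (f : k → (Fin 5 → k)) (I : Set k), I.Infinite →
      (∀ t ∈ I, ∀ v, T (f t) (f t) v = 0) →
      (∀ t ∈ I, f t ≠ 0) → (∀ s ∈ I, ∀ t ∈ I, ∀ c : k, c • f t = f s → s = t) → False := by
    intro f I hI h1 h2 h3
    have : Infinite I := hI.to_subtype
    have hinj : Function.Injective
        (fun t : I => Projectivization.mk k (f t) (h2 t t.2)) := by
      intro s t hst
      obtain ⟨c, hc⟩ := (Projectivization.mk_eq_mk_iff' k _ _ _ _).1 hst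
      exact Subtype.ext (h3 s s.2 t t.2 c hc)
    refine (Set.infinite_range_of_injective hinj) (hfin.subset ?_)
    rintro _ ⟨t, rfl⟩
    show ∀ i, eval (Projectivization.mk k (f t) (h2 t t.2)).rep (pderiv i F) = 0
    rw [← sing_iff]
    intro v
    obtain ⟨r, hr⟩ := (Projectivization.mk_eq_mk_iff' k _ _
      (Projectivization.rep_nonzero _) (h2 t t.2)).1
      (Projectivization.mk_rep (Projectivization.mk k (f t) (h2 t t.2)))
    rw [← hr]
    simp [h1 t t.2]
  have hS : ∀ i v, T (p i) (p i) v = 0 := fun i => (sing_iff _).2 (hsing i)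
  have hpair : ∀ i j, i ≠ j → LinearIndependent k ![p i, p j] := by
    intro i j hij
    rw [LinearIndependent.pair_iff' (hp i)]
    intro a ha
    exact hdist j i hij.symm ((Projectivization.mk_eq_mk_iff' k _ _ _ _).2 ⟨a, ha⟩)
  have htri : ∀ i j l, i ≠ j → i ≠ l → j ≠ l → LinearIndependent k ![p i, p j, p l] :=
    fun i j l h1 h2 h3 => aux_indep T h12 Hfin _ _ _ (hS i) (hS j) (hS l)
      (hpair _ _ h1) (hpair _ _ h2) (hpair _ _ h3)
  have htri3 : ∀ i j l, i ≠ j → i ≠ l → j ≠ l → ∀ X Y Z : k,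
      X • p i + Y • p j + Z • p l = 0 → X = 0 ∧ Y = 0 ∧ Z = 0 := by
    intro i j l h1 h2 h3 X Y Z h
    have := Fintype.linearIndependent_iff.1 (htri i j l h1 h2 h3) ![X, Y, Z]
      (by simpa [Fin.sum_univ_three] using h)
    exact ⟨this 0, this 1, this 2⟩
  have hli := htri 0 1 2 (by decide) (by decide) (by decide)
  have hspan : Submodule.span k (Set.range ![p 0, p 1, p 2]) = W := by
    apply Submodule.eq_of_le_of_finrank_eq
    · rw [Submodule.span_le]
      rintro _ ⟨i, rfl⟩
      fin_cases i
      · exact hmem 0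
      · exact hmem 1
      · exact hmem 2
    · rw [finrank_span_eq_card hli, hWdim]; rfl
  have hex : ∀ w ∈ W, ∃ x y z : k, w = x • p 0 + y • p 1 + z • p 2 := by
    intro w hw
    rw [← hspan, Submodule.mem_span_range_iff_exists_fun] at hw
    obtain ⟨g, hg⟩ := hw
    refine ⟨g 0, g 1, g 2, ?_⟩
    rw [← hg]; simp [Fin.sum_univ_three]
  obtain ⟨α, β, γ, h3⟩ := hex (p 3) (hmem 3)
  have hα : α ≠ 0 := by
    intro h0
    refine one_ne_zero (htri3 3 1 2 (by decide) (by decide) (by decide) 1 (-β) (-γ) ?_).1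
    rw [h3, h0]; module
  have hβ : β ≠ 0 := by
    intro h0
    refine one_ne_zero (htri3 3 0 2 (by decide) (by decide) (by decide) 1 (-α) (-γ) ?_).1
    rw [h3, h0]; module
  have hγ : γ ≠ 0 := by
    intro h0
    refine one_ne_zero (htri3 3 0 1 (by decide) (by decide) (by decide) 1 (-α) (-β) ?_).1
    rw [h3, h0]; module
  have hex' : ∀ w ∈ W, ∃ x y z : k, w = x • (α • p 0) + y • (β • p 1) + z • (γ • p 2) := by
    intro w hw
    obtain ⟨x, y, z, h⟩ := hex w hw
    refine ⟨x / α, y / β, z / γ, ?_⟩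
    simp only [smul_smul, div_mul_cancel₀ _ hα, div_mul_cancel₀ _ hβ, div_mul_cancel₀ _ hγ, h]
  have hli' : LinearIndependent k ![α • p 0, β • p 1, γ • p 2] := by
    rw [Fintype.linearIndependent_iff]
    intro g hg
    have := htri3 0 1 2 (by decide) (by decide) (by decide) (g 0 * α) (g 1 * β) (g 2 * γ)
      (by simpa [Fin.sum_univ_three, smul_smul] using hg)
    simp only [mul_eq_zero, hα, hβ, hγ, or_false] at this
    intro i
    fin_cases i
    · exact this.1
    · exact this.2.1
    · exact this.2.2
  have main := aux_main T h12 h23 Hfin (α • p 0) (β • p 1) (γ • p 2)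
    (by simp [hS]) (by simp [hS]) (by simp [hS]) (by rw [← h3]; exact hS 3) hli'
  constructor
  · intro w hw
    obtain ⟨x, y, z, h⟩ := hex' w hw
    have h1 := (main x y z).1
    simp only at h1
    rw [← h, hT3] at h1
    simpa using h1
  · intro s hs hsW hsing'
    obtain ⟨x, y, z, h⟩ := hex' s hsW
    have h1 := (main x y z).2 (by rw [← h]; exact (sing_iff s).2 hsing')
    simp only [Projectivization.mk_eq_mk_iff']
    rcases h1 with ⟨hx, hy⟩ | ⟨hy, hz⟩ | ⟨hx, hz⟩ | ⟨hxy, hyz⟩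
    · refine ⟨2, z * γ, ?_⟩
      rw [h, hx, hy]; module
    · refine ⟨0, x * α, ?_⟩
      rw [h, hy, hz]; module
    · refine ⟨1, y * β, ?_⟩
      rw [h, hx, hz]; module
    · refine ⟨3, x, ?_⟩
      rw [h, h3, ← hyz, ← hxy]; module
end

section
/- Let F = x₀x₁x₂ − x₃x₄x₅ ∈ k[x₀,...,x₅] and Z = {F = 0} ⊂ ℙ⁵. Let W ⊂ k⁶ be a 5-dimensional linear subspace with H = ℙ(W), and let G = F|_W be the induced cubic form on W, cutting out Y = Z ∩ H in ℙ(W) ≅ ℙ⁴. Assume Y has exactly nine singular points and each of them is a node. Then for every linear automorphism τ ∈ GL(W) such that G∘τ = λ·G for some λ ∈ k*, there exists ĝ ∈ GL₆(k) with ĝ(W) = W, with ĝ|_W = τ, and with F∘ĝ = μ·F for some μ ∈ k* (i.e. every automorphism of Y is induced by an automorphism of ℙ⁵ preserving Z and H). -/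
open MvPolynomial

lemma aux_rect {k : Type} [Field k] (e f g h : Fin 3 × Fin 3) (a b c d : k)
    (ha : a ≠ 0) (hb : b ≠ 0) (heg : e ≠ g) (heh : e ≠ h)
    (h1 : ∀ t, (if e.1 = t then a else 0) + (if f.1 = t then b else 0)
      + (if g.1 = t then c else 0) + (if h.1 = t then d else 0) = 0)
    (h2 : ∀ t, (if e.2 = t then a else 0) + (if f.2 = t then b else 0)
      + (if g.2 = t then c else 0) + (if h.2 = t then d else 0) = 0) :
    e.1 = f.1 ∨ e.2 = f.2 ∨ g = (e.1, f.2) ∨ h = (e.1, f.2) := by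
  obtain ⟨e1, e2⟩ := e
  obtain ⟨f1, f2⟩ := f
  obtain ⟨g1, g2⟩ := g
  obtain ⟨h1', h2'⟩ := h
  by_contra hcon
  simp only [not_or, Prod.mk.injEq, ne_eq] at *
  obtain ⟨n1, n2, n3, n4⟩ := hcon
  have A1 := h1 e1
  have A2 := h1 f1
  have B1 := h2 e2
  have B2 := h2 f2
  have k1 : g1 = e1 ∨ h1' = e1 := by
    by_contra hh; push Not at hh
    simp [hh.1, hh.2, Ne.symm n1] at A1; exact ha A1
  have k2 : g1 = f1 ∨ h1' = f1 := by
    by_contra hh; push Not at hh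
    simp [hh.1, hh.2, n1] at A2; exact hb A2
  have k3 : g2 = e2 ∨ h2' = e2 := by
    by_contra hh; push Not at hh
    simp [hh.1, hh.2, Ne.symm n2] at B1; exact ha B1
  have k4 : g2 = f2 ∨ h2' = f2 := by
    by_contra hh; push Not at hh
    simp [hh.1, hh.2, n2] at B2; exact hb B2
  clear A1 A2 B1 B2 h1 h2
  grind

lemma aux_third (i l : Fin 3) (h : i ≠ l) : ∃ m m' : Fin 3, m ≠ m' ∧ m ≠ i ∧ m ≠ l := by
  revert i l; decide

lemma aux_two (i : Fin 3) : ∃ m m' : Fin 3, m ≠ m' ∧ m ≠ i ∧ m' ≠ i := by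
  revert i; decide

lemma aux_inj4 (a b c d : Fin 3) (h : a ≠ b) (h' : a ≠ c) (h2 : b ≠ c)
    (h3 : a ≠ d) (h4 : b ≠ d) (h5 : c ≠ d) : False := by
  omega

/-- adjacency preserving injections where one row goes into a row -/
lemma aux_comb (π : Fin 3 × Fin 3 → Fin 3 × Fin 3) (hπ : Function.Injective π)
    (hr : ∀ i j l, (π (i, j)).1 = (π (i, l)).1 ∨ (π (i, j)).2 = (π (i, l)).2)
    (hc : ∀ i m j, (π (i, j)).1 = (π (m, j)).1 ∨ (π (i, j)).2 = (π (m, j)).2)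
    (h0 : (π (0, 0)).1 = (π (0, 1)).1) :
    ∃ σ ρ : Fin 3 → Fin 3, ∀ i j, π (i, j) = (σ i, ρ j) := by
  have inj : ∀ x y, x ≠ y → (π x).1 = (π y).1 → (π x).2 ≠ (π y).2 := by
    intro x y hxy h1 h2
    exact hxy (hπ (Prod.ext h1 h2))
  have d01 := inj (0,0) (0,1) (by decide) h0
  have h02 : (π (0, 2)).1 = (π (0, 0)).1 := by
    rcases hr 0 2 0 with h | h
    · exact h
    · rcases hr 0 2 1 with h' | h'
      · exact h'.trans h0.symm
      · exact absurd (h.symm.trans h') d01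
  have hrow : ∀ j, (π (0, j)).1 = (π (0, 0)).1 := by
    intro j; fin_cases j
    · rfl
    · exact h0.symm
    · exact h02
  have hcol : ∀ i j, (π (i, j)).2 = (π (0, j)).2 := by
    intro i j
    by_cases hi : i = 0
    · rw [hi]
    rcases hc i 0 j with h | h
    · exfalso
      have h' := h.trans (hrow j)
      have ne : ∀ l, (π (0, l)).2 ≠ (π (i, j)).2 := fun l =>
        inj _ _ (by simp [Ne.symm hi]) ((hrow l).trans h'.symm)
      refine aux_inj4 (π (0,0)).2 (π (0,1)).2 (π (0,2)).2 (π (i,j)).2 d01 ?_ ?_ (ne 0) (ne 1) (ne 2)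
      · exact inj _ _ (by decide) h02.symm
      · exact inj _ _ (by decide) (h0.symm.trans h02.symm)
    · exact h
  refine ⟨fun i => (π (i, 0)).1, fun j => (π (0, j)).2, fun i j => ?_⟩
  refine Prod.ext ?_ (hcol i j)
  rcases hr i j 0 with h | h
  · exact h
  · rw [hcol i j, hcol i 0] at h
    by_cases hj : j = 0
    · rw [hj]
    · exact absurd h (inj _ _ (by simp [hj]) (hrow j))

lemma aux_scal {k : Type} [Field k] (c : Fin 3 × Fin 3 → k)
    (σ ρ : Fin 3 → Fin 3)
    (hσ : Function.Injective σ) (hρ : Function.Injective ρ)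
    (h1 : ∀ i m j l t, (if σ i = t then c (i, j) else 0) + (if σ m = t then c (m, l) else 0)
      = (if σ i = t then c (i, l) else 0) + (if σ m = t then c (m, j) else 0))
    (h2 : ∀ i m j l t, (if ρ j = t then c (i, j) else 0) + (if ρ l = t then c (m, l) else 0)
      = (if ρ l = t then c (i, l) else 0) + (if ρ j = t then c (m, j) else 0)) :
    ∀ i j, c (i, j) = c (0, 0) := by
  have A : ∀ i j l, c (i, j) = c (i, l) := by
    intro i j l
    obtain ⟨m, _, _, hm, _⟩ := aux_two i
    simpa [hσ.ne hm] using h1 i m j l (σ i)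
  have B : ∀ i m j, c (i, j) = c (m, j) := by
    intro i m j
    obtain ⟨l, _, _, hl, _⟩ := aux_two j
    simpa [hρ.ne hl] using h2 i m j l (ρ j)
  intro i j
  rw [A i j 0, B i 0 0]

lemma aux_main_s7 {k : Type} [Field k] (c : Fin 3 × Fin 3 → k) (hc : ∀ e, c e ≠ 0)
    (π : Fin 3 × Fin 3 → Fin 3 × Fin 3) (hπ : Function.Injective π)
    (h1 : ∀ i m j l t, (if (π (i, j)).1 = t then c (i, j) else 0)
      + (if (π (m, l)).1 = t then c (m, l) else 0)
      = (if (π (i, l)).1 = t then c (i, l) else 0) + (if (π (m, j)).1 = t then c (m, j) else 0))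
    (h2 : ∀ i m j l t, (if (π (i, j)).2 = t then c (i, j) else 0)
      + (if (π (m, l)).2 = t then c (m, l) else 0)
      = (if (π (i, l)).2 = t then c (i, l) else 0) + (if (π (m, j)).2 = t then c (m, j) else 0)) :
    ∃ σ ρ : Fin 3 → Fin 3, Function.Injective σ ∧ Function.Injective ρ ∧
      (∀ i j, c (i, j) = c (0, 0)) ∧
      ((∀ i j, π (i, j) = (σ i, ρ j)) ∨ (∀ i j, π (i, j) = (ρ j, σ i))) := by
  have negif : ∀ (p : Prop) [Decidable p] (x : k), (if p then -x else 0) = - (if p then x else 0) := by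
    intro p _ x; split_ifs <;> simp
  have hr : ∀ i j l, (π (i, j)).1 = (π (i, l)).1 ∨ (π (i, j)).2 = (π (i, l)).2 := by
    intro i j l
    by_cases hjl : j = l
    · left; rw [hjl]
    obtain ⟨m, m', hmm, hm, hm'⟩ := aux_two i
    have key : ∀ n, n ≠ i → _ := fun n hn =>
      aux_rect (π (i,j)) (π (i,l)) (π (n,l)) (π (n,j)) (c (i,j)) (-c (i,l)) (c (n,l)) (-c (n,j))
        (hc _) (neg_ne_zero.mpr (hc _)) (hπ.ne (by simp [Ne.symm hn])) (hπ.ne (by simp [Ne.symm hn]))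
        (fun t => by rw [negif, negif]; linear_combination h1 i n j l t)
        (fun t => by rw [negif, negif]; linear_combination h2 i n j l t)
    have n1 : π (m, l) ≠ π (m', l) := hπ.ne (by simp [hmm])
    have n2 : π (m, l) ≠ π (m', j) := hπ.ne (by simp [hmm])
    have n3 : π (m, j) ≠ π (m', l) := hπ.ne (by simp [hmm])
    have n4 : π (m, j) ≠ π (m', j) := hπ.ne (by simp [hmm])
    have k1 := key m hm
    have k2 := key m' hm'
    grind
  have hcc : ∀ i m j, (π (i, j)).1 = (π (m, j)).1 ∨ (π (i, j)).2 = (π (m, j)).2 := by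
    intro i m j
    by_cases him : i = m
    · left; rw [him]
    obtain ⟨l, l', hll, hl, hl'⟩ := aux_two j
    have key : ∀ n, n ≠ j → _ := fun n hn =>
      aux_rect (π (i,j)) (π (m,j)) (π (m,n)) (π (i,n)) (c (i,j)) (-c (m,j)) (c (m,n)) (-c (i,n))
        (hc _) (neg_ne_zero.mpr (hc _)) (hπ.ne (by simp [Ne.symm hn])) (hπ.ne (by simp [Ne.symm hn]))
        (fun t => by rw [negif, negif]; linear_combination h1 i m j n t)
        (fun t => by rw [negif, negif]; linear_combination h2 i m j n t)
    have n1 : π (m, l) ≠ π (m, l') := hπ.ne (by simp [hll])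
    have n2 : π (m, l) ≠ π (i, l') := hπ.ne (by simp [hll])
    have n3 : π (i, l) ≠ π (m, l') := hπ.ne (by simp [hll])
    have n4 : π (i, l) ≠ π (i, l') := hπ.ne (by simp [hll])
    have k1 := key l hl
    have k2 := key l' hl'
    grind
  rcases hr 0 0 1 with h0 | h0
  · obtain ⟨σ, ρ, h⟩ := aux_comb π hπ hr hcc h0
    have hσ : Function.Injective σ := by
      intro i m him
      have : π (i, 0) = π (m, 0) := by rw [h, h, him]
      exact congrArg Prod.fst (hπ this)
    have hρ : Function.Injective ρ := by
      intro i m him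
      have : π (0, i) = π (0, m) := by rw [h, h, him]
      exact congrArg Prod.snd (hπ this)
    refine ⟨σ, ρ, hσ, hρ, ?_, Or.inl h⟩
    simp only [h] at h1 h2
    exact aux_scal c σ ρ hσ hρ h1 h2
  · obtain ⟨σ, ρ, h'⟩ := aux_comb (fun e => (π e).swap) (Prod.swap_injective.comp hπ)
      (fun i j l => (hr i j l).symm) (fun i j l => (hcc i j l).symm) h0
    have h : ∀ i j, π (i, j) = (ρ j, σ i) := by
      intro i j
      have := congrArg Prod.swap (h' i j)
      simpa using this
    have hσ : Function.Injective σ := by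
      intro i m him
      have : π (i, 0) = π (m, 0) := by rw [h, h, him]
      exact congrArg Prod.fst (hπ this)
    have hρ : Function.Injective ρ := by
      intro i m him
      have : π (0, i) = π (0, m) := by rw [h, h, him]
      exact congrArg Prod.snd (hπ this)
    refine ⟨σ, ρ, hσ, hρ, ?_, Or.inr h⟩
    simp only [h] at h1 h2
    exact aux_scal c σ ρ hσ hρ h2 h1

def aR (i : Fin 3) : Fin 6 := finSumFinEquiv (m := 3) (n := 3) (Sum.inl i)
def aC (i : Fin 3) : Fin 6 := finSumFinEquiv (m := 3) (n := 3) (Sum.inr i)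

lemma aR_inj : Function.Injective aR := by decide
lemma aC_inj : Function.Injective aC := by decide
lemma aR_ne_aC (i j : Fin 3) : aR i ≠ aC j := by revert i j; decide
lemma aRC_cases (s : Fin 6) : (∃ i, s = aR i) ∨ (∃ j, s = aC j) := by revert s; decide

section
variable {k : Type} [Field k]

def aE (a : Fin 6 → k) (s : Fin 6) : Fin 6 → k := Pi.single s (a s)⁻¹

def aP (a : Fin 6 → k) (e : Fin 3 × Fin 3) : Fin 6 → k := aE a (aR e.1) - aE a (aC e.2)

def aF (v : Fin 6 → k) : k := v 0 * v 1 * v 2 - v 3 * v 4 * v 5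

def aD (p v : Fin 6 → k) : k :=
  v 0 * (p 1 * p 2) + v 1 * (p 0 * p 2) + v 2 * (p 0 * p 1)
   - v 3 * (p 4 * p 5) - v 4 * (p 3 * p 5) - v 5 * (p 3 * p 4)

lemma aF_prod (v : Fin 6 → k) : aF v = ∏ i, v (aR i) - ∏ i, v (aC i) := by
  simp only [Fin.prod_univ_three]; rfl

lemma aE_self (a : Fin 6 → k) (ha : ∀ i, a i ≠ 0) (s t : Fin 6) :
    a t * aE a s t = if s = t then 1 else 0 := by
  unfold aE
  by_cases h : s = t
  · subst h; simp [ha]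
  · simp [h, Ne.symm h]

lemma aP_R (a : Fin 6 → k) (ha : ∀ i, a i ≠ 0) (e : Fin 3 × Fin 3) (t : Fin 3) :
    a (aR t) * aP a e (aR t) = if e.1 = t then 1 else 0 := by
  unfold aP
  rw [Pi.sub_apply, mul_sub, aE_self a ha, aE_self a ha, if_neg (aR_ne_aC _ _).symm]
  simp [aR_inj.eq_iff]

lemma aP_C (a : Fin 6 → k) (ha : ∀ i, a i ≠ 0) (e : Fin 3 × Fin 3) (t : Fin 3) :
    a (aC t) * aP a e (aC t) = - if e.2 = t then 1 else 0 := by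
  unfold aP
  rw [Pi.sub_apply, mul_sub, aE_self a ha, aE_self a ha, if_neg (aR_ne_aC _ _)]
  simp [aC_inj.eq_iff]

lemma aP_sum (a : Fin 6 → k) (ha : ∀ i, a i ≠ 0) (e : Fin 3 × Fin 3) :
    ∑ s, a s * aP a e s = 0 := by
  unfold aP
  simp only [Pi.sub_apply, mul_sub, aE_self a ha, Finset.sum_sub_distrib]
  simp

lemma aP_par (a : Fin 6 → k) (ha : ∀ i, a i ≠ 0) (e f : Fin 3 × Fin 3) (c d : k) (hc : c ≠ 0)
    (h : c • aP a e = d • aP a f) : e = f := by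
  have h1 := congrArg (fun v => a (aR e.1) * v (aR e.1)) h
  have h2 := congrArg (fun v => a (aC e.2) * v (aC e.2)) h
  simp only [Pi.smul_apply, smul_eq_mul, mul_left_comm, aP_R a ha, aP_C a ha] at h1 h2
  refine Prod.ext ?_ ?_
  · by_contra hh
    simp [Ne.symm hh] at h1; exact hc h1
  · by_contra hh
    simp [Ne.symm hh] at h2; exact hc h2

/-- the monomial map sending `E_s` to `d E_{Q s}` -/
def aG (a : Fin 6 → k) (ha : ∀ i, a i ≠ 0) (Q : Equiv.Perm (Fin 6)) (d : k) (hd : d ≠ 0) :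
    (Fin 6 → k) ≃ₗ[k] (Fin 6 → k) where
  toFun v t := d * a (Q.symm t) * v (Q.symm t) / a t
  invFun v s := a (Q s) * v (Q s) / (d * a s)
  map_add' u v := by ext t; simp only [Pi.add_apply]; ring
  map_smul' u v := by ext t; simp only [Pi.smul_apply, smul_eq_mul, RingHom.id_apply]; ring
  left_inv v := by
    ext s; have := ha s; have := ha (Q s); simp only [Equiv.symm_apply_apply]; field_simp
  right_inv v := by
    ext s; have := ha s; have := ha (Q.symm s); simp only [Equiv.apply_symm_apply]; field_simp

lemma aG_apply (a : Fin 6 → k) (ha : ∀ i, a i ≠ 0) (Q : Equiv.Perm (Fin 6)) (d : k) (hd : d ≠ 0)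
    (v : Fin 6 → k) (s : Fin 6) : aG a ha Q d hd v (Q s) = d * a s / a (Q s) * v s := by
  change d * a (Q.symm (Q s)) * v (Q.symm (Q s)) / a (Q s) = _
  rw [Equiv.symm_apply_apply]; ring

lemma aG_E (a : Fin 6 → k) (ha : ∀ i, a i ≠ 0) (Q : Equiv.Perm (Fin 6)) (d : k) (hd : d ≠ 0)
    (s : Fin 6) : aG a ha Q d hd (aE a s) = d • aE a (Q s) := by
  ext t
  obtain ⟨r, rfl⟩ := Q.surjective t
  apply mul_left_cancel₀ (ha (Q r))
  rw [aG_apply, Pi.smul_apply, smul_eq_mul, mul_left_comm _ d, aE_self a ha]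
  have h := aE_self a ha s r
  have h3 : a (Q r) * (d * a r / a (Q r) * aE a s r) = d * (a r * aE a s r) := by
    field_simp [ha (Q r)]
  rw [h3, h]; simp

lemma aux_glue (W : Submodule k (Fin 6 → k)) (a : Fin 6 → k) (ha : ∀ i, a i ≠ 0)
    [CharZero k]
    (hW : ∀ v, v ∈ W ↔ ∑ s, a s * v s = 0) (τ : W ≃ₗ[k] W) (lam : k)
    (hτ : ∀ w : W, aF (τ w : Fin 6 → k) = lam * aF (w : Fin 6 → k))
    (g : (Fin 6 → k) ≃ₗ[k] (Fin 6 → k))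
    (hg : ∀ e (h : aP a e ∈ W), g (aP a e) = (τ ⟨aP a e, h⟩ : Fin 6 → k))
    (α β : k)
    (hgF : ∀ v, aF (g v) = α * (v 0 * v 1 * v 2) + β * (v 3 * v 4 * v 5)) :
      Submodule.map (g : (Fin 6 → k) →ₗ[k] (Fin 6 → k)) W = W ∧
      (∀ w : W, g (w : Fin 6 → k) = (τ w : Fin 6 → k)) ∧
      (∀ v : Fin 6 → k, aF (g v) = lam * aF v) := by
  have hPW : ∀ e, aP a e ∈ W := fun e => (hW _).2 (aP_sum a ha e)
  have hgτ : ∀ w : W, g (w : Fin 6 → k) = (τ w : Fin 6 → k) := by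
    intro w
    let p : Fin 3 × Fin 3 → W := fun e => ⟨aP a e, hPW e⟩
    let y : Fin 6 → k := fun s => a s * (w : Fin 6 → k) s
    have hy : ∑ s, y s = 0 := (hW _).1 w.2
    have hw : w = ∑ i, y (aR i) • p (i, 0) - ∑ j, y (aC j) • p (0, j)
        + (∑ j, y (aC j)) • p (0, 0) := by
      apply Subtype.ext
      ext s
      apply mul_left_cancel₀ (ha s)
      change y s = _
      simp only [Submodule.coe_add, Submodule.coe_sub, Submodule.coe_smul, Submodule.coe_sum,
        Pi.add_apply, Pi.sub_apply, Pi.smul_apply, Finset.sum_apply, smul_eq_mul, mul_add, mul_sub,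
        Finset.mul_sum, mul_left_comm (a s), p]
      rw [Fin.sum_univ_six] at hy
      rcases aRC_cases s with ⟨i, rfl⟩ | ⟨i, rfl⟩
      · simp only [aP_R a ha, Fin.sum_univ_three]
        fin_cases i <;> simp
      · simp only [aP_C a ha, Fin.sum_univ_three]
        fin_cases i <;> simp
        change y 3 = -y 0 + -y 1 + -y 2 + y 3 + (-y 5 + (-y 4 + - y 3))
        linear_combination hy
    have hgp : ∀ e, g (p e : Fin 6 → k) = (τ (p e) : Fin 6 → k) := fun e => hg e (hPW e)
    rw [hw]
    simp only [Submodule.coe_add, Submodule.coe_sub, Submodule.coe_smul, Submodule.coe_sum,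
      map_add, map_sub, map_sum, map_smul, hgp]
  refine ⟨?_, hgτ, ?_⟩
  · ext v
    simp only [Submodule.mem_map]
    constructor
    · rintro ⟨u, hu, rfl⟩
      have := hgτ ⟨u, hu⟩
      change g u ∈ W
      simp only at this
      rw [this]; exact (τ _).2
    · intro hv
      refine ⟨τ.symm ⟨v, hv⟩, (τ.symm ⟨v, hv⟩).2, ?_⟩
      have := hgτ (τ.symm ⟨v, hv⟩)
      rw [LinearEquiv.apply_symm_apply] at this
      exact this
  · have key : ∀ w ∈ W, α * (w 0 * w 1 * w 2) + β * (w 3 * w 4 * w 5)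
        = lam * (w 0 * w 1 * w 2 - w 3 * w 4 * w 5) := by
      intro w hw
      rw [← hgF]
      have := hτ ⟨w, hw⟩
      rw [← hgτ] at this
      exact this
    have hα : α = lam := by
      have := key ![(a 0)⁻¹, (a 1)⁻¹, -2 * (a 2)⁻¹, 0, 0, 0] (by
        rw [hW, Fin.sum_univ_six]
        simp [ha, mul_left_comm (a 2)]; norm_num)
      simp [ha] at this
      exact this
    have hβ : β = -lam := by
      have := key ![0, 0, 0, (a 3)⁻¹, (a 4)⁻¹, -2 * (a 5)⁻¹] (by
        rw [hW, Fin.sum_univ_six]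
        simp [ha, mul_left_comm (a 5)]; norm_num)
      have hne : (a 3)⁻¹ * (a 4)⁻¹ * (2 * (a 5)⁻¹) ≠ 0 := by simp [ha]
      simp at this
      apply mul_right_cancel₀ hne
      linear_combination -this
    intro v
    rw [hgF, hα, hβ]
    unfold aF; ring

lemma aux_core [CharZero k] (W : Submodule k (Fin 6 → k)) (a : Fin 6 → k) (ha : ∀ i, a i ≠ 0)
    (hW : ∀ v, v ∈ W ↔ ∑ s, a s * v s = 0) (τ : W ≃ₗ[k] W) (lam : k)
    (hτ : ∀ w : W, aF (τ w : Fin 6 → k) = lam * aF (w : Fin 6 → k))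
    (hsing : ∀ p : W, p ≠ 0 → (∀ v : W, aD (p : Fin 6 → k) v = 0) →
      ∃ (c : k) (e : Fin 3 × Fin 3), (p : Fin 6 → k) = c • aP a e) :
    ∃ (g : (Fin 6 → k) ≃ₗ[k] (Fin 6 → k)),
      Submodule.map (g : (Fin 6 → k) →ₗ[k] (Fin 6 → k)) W = W ∧
      (∀ w : W, g (w : Fin 6 → k) = (τ w : Fin 6 → k)) ∧
      (∀ v : Fin 6 → k, aF (g v) = lam * aF v) := by
  have hPW : ∀ e, aP a e ∈ W := fun e => (hW _).2 (aP_sum a ha e)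
  have hP0 : ∀ e, aP a e ≠ 0 := by
    intro e h
    have := aP_R a ha e e.1
    simp [h] at this
  have pol : ∀ p v : Fin 6 → k, 2 * aD p v = aF (p + v) - aF (p - v) - 2 * aF v := by
    intro p v
    simp only [aD, aF, Pi.add_apply, Pi.sub_apply]; ring
  have hDτ : ∀ p v : W, aD (τ p : Fin 6 → k) (τ v) = lam * aD (p : Fin 6 → k) v := by
    intro p v
    have h2 : (2 : k) ≠ 0 := two_ne_zero
    apply mul_left_cancel₀ h2
    have e1 := hτ (p + v)
    have e2 := hτ (p - v)
    have e3 := hτ v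
    simp only [map_add, map_sub, Submodule.coe_add, Submodule.coe_sub] at e1 e2
    rw [mul_left_comm, pol, pol, e1, e2, e3]; ring
  have hDP : ∀ e v, aD (aP a e) v = 0 := by
    rintro ⟨i, j⟩ v
    fin_cases i <;> fin_cases j <;>
      simp [aD, aP, aE, aR, aC, finSumFinEquiv, Pi.single_apply, Fin.ext_iff]
  let p : Fin 3 × Fin 3 → W := fun e => ⟨aP a e, hPW e⟩
  have hp0 : ∀ e, p e ≠ 0 := fun e h => hP0 e (congrArg Subtype.val h)
  have hex : ∀ e, ∃ (c : k) (f : Fin 3 × Fin 3), (τ (p e) : Fin 6 → k) = c • aP a f := by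
    intro e
    apply hsing
    · simpa using hp0 e
    · intro v
      obtain ⟨u, rfl⟩ := τ.surjective v
      rw [hDτ, hDP, mul_zero]
  choose c π hcπ using hex
  have hc : ∀ e, c e ≠ 0 := by
    intro e h
    have := hcπ e
    rw [h, zero_smul] at this
    have h' : τ (p e) = 0 := Subtype.ext this
    exact hp0 e (by simpa using h')
  have hπ : Function.Injective π := by
    intro e f hef
    have h : c f • τ (p e) = c e • τ (p f) := by
      apply Subtype.ext
      simp only [Submodule.coe_smul, hcπ, hef, smul_smul, mul_comm]
    rw [← map_smul, ← map_smul] at h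
    have h' := congrArg Subtype.val (τ.injective h)
    exact aP_par a ha e f (c f) (c e) (hc f) h'
  have hrel : ∀ i m j l, c (i, j) • aP a (π (i, j)) + c (m, l) • aP a (π (m, l))
      = c (i, l) • aP a (π (i, l)) + c (m, j) • aP a (π (m, j)) := by
    intro i m j l
    simp only [← hcπ, ← Submodule.coe_add, ← map_add]
    congr 2
    apply Subtype.ext
    simp only [Submodule.coe_add, p, aP]
    abel
  obtain ⟨σ', ρ', hσ, hρ, hcc, hor⟩ := aux_main_s7 c hc π hπ
    (fun i m j l t => by
      have := congrArg (fun v => a (aR t) * v (aR t)) (hrel i m j l)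
      simpa only [Pi.add_apply, Pi.smul_apply, smul_eq_mul, mul_add, mul_left_comm (a (aR t)),
        aP_R a ha, mul_ite, mul_one, mul_zero] using this)
    (fun i m j l t => by
      have := congrArg (fun v => - (a (aC t) * v (aC t))) (hrel i m j l)
      simpa only [Pi.add_apply, Pi.smul_apply, smul_eq_mul, mul_add, mul_left_comm (a (aC t)),
        aP_C a ha, mul_ite, mul_one, mul_zero, mul_neg, neg_add_rev, neg_neg, add_comm] using this)
  let σ : Equiv.Perm (Fin 3) := Equiv.ofBijective σ' (Finite.injective_iff_bijective.1 hσ)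
  let ρ : Equiv.Perm (Fin 3) := Equiv.ofBijective ρ' (Finite.injective_iff_bijective.1 hρ)
  have prodlem : ∀ (v : Fin 6 → k) (g : (Fin 6 → k) → Fin 6 → k) (θ : Equiv.Perm (Fin 3))
      (A B : Fin 3 → Fin 6) (q : Fin 3 → k), (∀ i, g v (A (θ i)) = q i * v (B i)) →
      ∏ i, g v (A i) = (∏ i, q i) * ∏ i, v (B i) := by
    intro v g θ A B q h
    rw [← Finset.prod_mul_distrib, ← Equiv.prod_comp θ]
    exact Finset.prod_congr rfl (fun i _ => h i)
  have pR : ∀ v : Fin 6 → k, ∏ i, v (aR i) = v 0 * v 1 * v 2 := fun v => by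
    rw [Fin.prod_univ_three]; rfl
  have pC : ∀ v : Fin 6 → k, ∏ i, v (aC i) = v 3 * v 4 * v 5 := fun v => by
    rw [Fin.prod_univ_three]; rfl
  rcases hor with hor | hor
  · let Q : Equiv.Perm (Fin 6) :=
      (finSumFinEquiv (m := 3) (n := 3)).symm.trans
        ((Equiv.sumCongr σ ρ).trans (finSumFinEquiv (m := 3) (n := 3)))
    have QR : ∀ i, Q (aR i) = aR (σ i) := fun i => by
      change finSumFinEquiv (Equiv.sumCongr σ ρ (finSumFinEquiv.symm (finSumFinEquiv (Sum.inl i)))) = _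
      rw [Equiv.symm_apply_apply]; rfl
    have QC : ∀ i, Q (aC i) = aC (ρ i) := fun i => by
      change finSumFinEquiv (Equiv.sumCongr σ ρ (finSumFinEquiv.symm (finSumFinEquiv (Sum.inr i)))) = _
      rw [Equiv.symm_apply_apply]; rfl
    refine ⟨aG a ha Q (c (0, 0)) (hc _), aux_glue W a ha hW τ lam hτ _ ?_
      (∏ i, (c (0, 0) * a (aR i) / a (aR (σ i))))
      (-∏ i, (c (0, 0) * a (aC i) / a (aC (ρ i)))) ?_⟩
    · rintro ⟨i, j⟩ h
      have hτP := hcπ (i, j)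
      rw [hor, hcc] at hτP
      refine Eq.trans ?_ hτP.symm
      simp only [aP, map_sub, aG_E, QR, QC, smul_sub]
      rfl
    · intro v
      rw [aF_prod, ← pR, ← pC,
        prodlem v (aG a ha Q (c (0, 0)) (hc _)) σ aR aR _
          (fun i => by rw [← QR]; exact aG_apply a ha Q _ _ v (aR i)),
        prodlem v (aG a ha Q (c (0, 0)) (hc _)) ρ aC aC _
          (fun i => by rw [← QC]; exact aG_apply a ha Q _ _ v (aC i))]
      simp only [QR, QC]; ring
  · let Q : Equiv.Perm (Fin 6) :=
      (finSumFinEquiv (m := 3) (n := 3)).symm.trans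
        (((Equiv.sumCongr σ ρ).trans (Equiv.sumComm _ _)).trans (finSumFinEquiv (m := 3) (n := 3)))
    have QR : ∀ i, Q (aR i) = aC (σ i) := fun i => by
      change finSumFinEquiv (Equiv.sumComm _ _ (Equiv.sumCongr σ ρ
        (finSumFinEquiv.symm (finSumFinEquiv (Sum.inl i))))) = _
      rw [Equiv.symm_apply_apply]; rfl
    have QC : ∀ i, Q (aC i) = aR (ρ i) := fun i => by
      change finSumFinEquiv (Equiv.sumComm _ _ (Equiv.sumCongr σ ρ
        (finSumFinEquiv.symm (finSumFinEquiv (Sum.inr i))))) = _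
      rw [Equiv.symm_apply_apply]; rfl
    refine ⟨aG a ha Q (-c (0, 0)) (neg_ne_zero.2 (hc _)), aux_glue W a ha hW τ lam hτ _ ?_
      (-∏ i, (-c (0, 0) * a (aR i) / a (aC (σ i))))
      (∏ i, (-c (0, 0) * a (aC i) / a (aR (ρ i)))) ?_⟩
    · rintro ⟨i, j⟩ h
      have hτP := hcπ (i, j)
      rw [hor, hcc] at hτP
      refine Eq.trans ?_ hτP.symm
      simp only [aP, map_sub, aG_E, QR, QC, smul_sub, neg_smul]
      rw [neg_sub_neg]
      rfl
    · intro v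
      rw [aF_prod, ← pR, ← pC,
        prodlem v (aG a ha Q (-c (0, 0)) (neg_ne_zero.2 (hc _))) σ aC aR _
          (fun i => by rw [← QR]; exact aG_apply a ha Q _ _ v (aR i)),
        prodlem v (aG a ha Q (-c (0, 0)) (neg_ne_zero.2 (hc _))) ρ aR aC _
          (fun i => by rw [← QC]; exact aG_apply a ha Q _ _ v (aC i))]
      simp only [QR, QC]; ring

end

lemma aux_rank {k : Type} [Field k] {V : Type} [AddCommGroup V] [Module k V]
    (B : V →ₗ[k] V →ₗ[k] k) (α β φ ψ : V →ₗ[k] k)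
    (hB : ∀ u v, B u v = α u * φ v + β u * ψ v) : LinearMap.rank B ≠ 4 := by
  classical
  intro h
  have hr : LinearMap.range B ≤ Submodule.span k (({φ, ψ} : Finset (V →ₗ[k] k)) : Set _) := by
    rintro _ ⟨u, rfl⟩
    have : B u = α u • φ + β u • ψ := by
      ext v; simp [hB]
    rw [this]
    refine Submodule.add_mem _ (Submodule.smul_mem _ _ (Submodule.subset_span (by simp)))
      (Submodule.smul_mem _ _ (Submodule.subset_span (by simp)))
  have h1 : LinearMap.rank B ≤ 2 := by
    refine (Submodule.rank_mono hr).trans ((rank_span_finset_le _).trans ?_)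
    exact_mod_cast Finset.card_le_two
  rw [h] at h1
  have : (4 : ℕ) ≤ 2 := by exact_mod_cast h1
  omega

lemma aux_hess {k : Type} [Field k] (F : MvPolynomial (Fin 6) k)
    (hF : F = X 0 * X 1 * X 2 - X 3 * X 4 * X 5) (p u v : Fin 6 → k) :
    Matrix.toLinearMap₂' k (Matrix.of fun i j => MvPolynomial.eval p
            (MvPolynomial.pderiv i (MvPolynomial.pderiv j F))) u v
      = p 0 * (u 1 * v 2 + u 2 * v 1) + p 1 * (u 0 * v 2 + u 2 * v 0)
        + p 2 * (u 0 * v 1 + u 1 * v 0) - p 3 * (u 4 * v 5 + u 5 * v 4)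
        - p 4 * (u 3 * v 5 + u 5 * v 3) - p 5 * (u 3 * v 4 + u 4 * v 3) := by
  subst hF
  rw [Matrix.toLinearMap₂'_apply]
  simp [Fin.sum_univ_six, pderiv_X, Pi.single_apply]
  ring

theorem stmt_7 {k : Type} [Field k] [IsAlgClosed k] [CharZero k]
    (F : MvPolynomial (Fin 6) k)
    (hF : F = X 0 * X 1 * X 2 - X 3 * X 4 * X 5)
    (W : Submodule k (Fin 6 → k)) (hW : Module.finrank k W = 5)
    (hnine : {x : Projectivization k W |
        ∀ v : W, ∑ i, (v : Fin 6 → k) i *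
          MvPolynomial.eval ((x.rep : Fin 6 → k)) (MvPolynomial.pderiv i F) = 0}.ncard = 9)
    (hnode : ∀ p : W, p ≠ 0 →
      (∀ v : W, ∑ i, (v : Fin 6 → k) i *
          MvPolynomial.eval ((p : Fin 6 → k)) (MvPolynomial.pderiv i F) = 0) →
      LinearMap.rank ((Matrix.toLinearMap₂' k
          (Matrix.of fun i j => MvPolynomial.eval ((p : Fin 6 → k))
            (MvPolynomial.pderiv i (MvPolynomial.pderiv j F)))).compl₁₂
          W.subtype W.subtype) = 4)
    (τ : W ≃ₗ[k] W) (lam : k) (hlam : lam ≠ 0)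
    (hτ : ∀ w : W, MvPolynomial.eval ((τ w : Fin 6 → k)) F
        = lam * MvPolynomial.eval ((w : Fin 6 → k)) F) :
    ∃ (g : (Fin 6 → k) ≃ₗ[k] (Fin 6 → k)) (μ : k), μ ≠ 0 ∧
      Submodule.map (g : (Fin 6 → k) →ₗ[k] (Fin 6 → k)) W = W ∧
      (∀ w : W, g (w : Fin 6 → k) = (τ w : Fin 6 → k)) ∧
      (∀ v : Fin 6 → k, MvPolynomial.eval (g v) F = μ * MvPolynomial.eval v F) := by
  have hE : ∀ v : Fin 6 → k, MvPolynomial.eval v F = aF v := by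
    intro v; subst hF; simp [aF]
  have hD : ∀ p v : Fin 6 → k, ∑ i, v i * MvPolynomial.eval p (MvPolynomial.pderiv i F)
      = aD p v := by
    intro p v; subst hF
    simp [Fin.sum_univ_six, pderiv_X, Pi.single_apply, aD]
    ring
  simp only [hE, hD] at *
  -- the hyperplane
  obtain ⟨a, ha0, hWa⟩ : ∃ a : Fin 6 → k, a ≠ 0 ∧ ∀ v, v ∈ W ↔ ∑ s, a s * v s = 0 := by
    have hlt : W < ⊤ := by
      rw [lt_top_iff_ne_top]; rintro rfl
      simp at hW
    obtain ⟨f, hf0, hf⟩ := Submodule.exists_le_ker_of_lt_top W hlt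
    have hker : W = LinearMap.ker f := by
      apply Submodule.eq_of_le_of_finrank_le hf
      have h1 := f.finrank_range_add_finrank_ker
      have h2 : LinearMap.range f = ⊤ := LinearMap.range_eq_top.2 (LinearMap.surjective hf0)
      rw [h2] at h1
      simp at h1
      omega
    have hfv : ∀ v, f v = ∑ s, f (Pi.single s 1) * v s := by
      intro v
      rw [LinearMap.pi_apply_eq_sum_univ f v]
      refine Finset.sum_congr rfl fun s _ => ?_
      rw [smul_eq_mul, mul_comm]
      congr 2
      ext t; simp [Pi.single_apply, eq_comm]
    refine ⟨fun s => f (Pi.single s 1), ?_, ?_⟩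
    · intro h
      apply hf0
      ext s
      simpa using congrFun h s
    · intro v
      rw [hker, LinearMap.mem_ker, hfv]
  have ha : ∀ i, a i ≠ 0 := by
    intro i hi
    have hmem : (Pi.single i 1 : Fin 6 → k) ∈ W := by
      rw [hWa]; simp [Pi.single_apply, hi]
    have h4 := hnode ⟨Pi.single i 1, hmem⟩ (by
      intro h
      have := congrFun (congrArg Subtype.val h) i
      simp at this) (by
      intro v
      fin_cases i <;> simp [aD])
    let x : Fin 6 → (W →ₗ[k] k) := fun j => (LinearMap.proj j).comp W.subtype
    revert h4
    fin_cases i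
    · exact aux_rank _ (x 1) (x 2) (x 2) (x 1) (fun u v => by
        rw [LinearMap.compl₁₂_apply, aux_hess F hF]; simp [x])
    · exact aux_rank _ (x 0) (x 2) (x 2) (x 0) (fun u v => by
        rw [LinearMap.compl₁₂_apply, aux_hess F hF]; simp [x])
    · exact aux_rank _ (x 0) (x 1) (x 1) (x 0) (fun u v => by
        rw [LinearMap.compl₁₂_apply, aux_hess F hF]; simp [x])
    · exact aux_rank _ (-x 4) (-x 5) (x 5) (x 4) (fun u v => by
        rw [LinearMap.compl₁₂_apply, aux_hess F hF]; simp [x]; ring)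
    · exact aux_rank _ (-x 3) (-x 5) (x 5) (x 3) (fun u v => by
        rw [LinearMap.compl₁₂_apply, aux_hess F hF]; simp [x]; ring)
    · exact aux_rank _ (-x 3) (-x 4) (x 4) (x 3) (fun u v => by
        rw [LinearMap.compl₁₂_apply, aux_hess F hF]; simp [x]; ring)
  have hPW : ∀ e, aP a e ∈ W := fun e => (hWa _).2 (aP_sum a ha e)
  have hP0 : ∀ e, aP a e ≠ 0 := by
    intro e h
    have := aP_R a ha e e.1
    simp [h] at this
  have hDP : ∀ e v, aD (aP a e) v = 0 := by
    rintro ⟨i, j⟩ v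
    fin_cases i <;> fin_cases j <;>
      simp [aD, aP, aE, aR, aC, finSumFinEquiv, Fin.ext_iff]
  let p : Fin 3 × Fin 3 → W := fun e => ⟨aP a e, hPW e⟩
  have hp0 : ∀ e, p e ≠ 0 := fun e h => hP0 e (congrArg Subtype.val h)
  have hDs : ∀ (c : k) (p v : Fin 6 → k), aD (c • p) v = c ^ 2 * aD p v := by
    intro c p v
    simp only [aD, Pi.smul_apply, smul_eq_mul]; ring
  let S : Set (Projectivization k W) :=
    {x | ∀ v : W, aD (x.rep : Fin 6 → k) (v : Fin 6 → k) = 0}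
  have hmemS : ∀ (q : W) (hq : q ≠ 0), (∀ v : W, aD (q : Fin 6 → k) v = 0) →
      Projectivization.mk k q hq ∈ S := by
    intro q hq h v
    obtain ⟨c, hc⟩ := Projectivization.exists_smul_eq_mk_rep k q hq
    rw [← hc]
    have := hDs (c : k) q v
    rw [h v, mul_zero] at this
    exact this
  let q : Fin 3 × Fin 3 → Projectivization k W := fun e => Projectivization.mk k (p e) (hp0 e)
  have hq : Function.Injective q := by
    intro e f hef
    obtain ⟨c, hc⟩ := (Projectivization.mk_eq_mk_iff' k _ _ (hp0 e) (hp0 f)).1 hef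
    have h' := congrArg Subtype.val hc
    refine aP_par a ha e f 1 c one_ne_zero ?_
    rw [one_smul]; exact h'.symm
  have hS : Set.range q = S := by
    apply Set.eq_of_subset_of_ncard_le
    · rintro _ ⟨e, rfl⟩
      exact hmemS _ _ (fun v => hDP e v)
    · rw [show S.ncard = 9 from hnine, ← Set.image_univ, Set.ncard_image_of_injective _ hq]
      simp [Set.ncard_univ]
    · exact Set.finite_of_ncard_ne_zero (by rw [show S.ncard = 9 from hnine]; norm_num)
  obtain ⟨g, h1, h2, h3⟩ := aux_core W a ha hWa τ lam hτ (by
    intro r hr h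
    have := hmemS r hr h
    rw [← hS] at this
    obtain ⟨e, he⟩ := this
    obtain ⟨c, hc⟩ := (Projectivization.mk_eq_mk_iff' k _ _ hr (hp0 e)).1 he.symm
    exact ⟨c, e, (congrArg Subtype.val hc).symm⟩)
  exact ⟨g, lam, hlam, h1, h2, h3⟩
end
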